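/- arXiv:1310.4681 — 2 statements merged into one kernel-verified Lean document; each statement's English description precedes it below -/
import Mathlib

section
/- There exist absolute constants A, B > 0 such that for every integer r ≥ 2 and every real t, 0 ≤ P(Bin(r, 1/2) ≤ t) - F_r(t) ≤ A·e^{-B·r}, where F_r(t) = ∏_p P(Bin(r, 1/p) ≤ t) with the product over all primes p. -/
open Finset

/-- CDF of the binomial distribution with `n` trials and success probability `q`,
evaluated at a real threshold `t`: the probability that `Bin(n,q) ≤ t`. -/
noncomputable def binomCdf (n : ℕ) (q t : ℝ) : ℝ :=
  ∑ k ∈ Finset.range (n + 1),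
    if (k : ℝ) ≤ t then (n.choose k : ℝ) * q ^ k * (1 - q) ^ (n - k) else 0

/-- The limiting distribution function of the random index of codivisibility:
`F_r(t) = ∏_p P(Bin(r, 1/p) ≤ t)`, the product over all primes `p`. -/
noncomputable def codivCdf (r : ℕ) (t : ℝ) : ℝ :=
  ∏' p : Nat.Primes, binomCdf r (1 / ((p : ℕ) : ℝ)) t

lemma cher (r : ℕ) (q s c : ℝ) (hq : 0 ≤ q) (hq1 : q ≤ 1) (hs : 0 < s) (P : ℕ → Prop)
    [DecidablePred P] (hP : ∀ k, P k → 1 ≤ s ^ ((k : ℝ) - c * r)) :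
    ∑ k ∈ Finset.range (r + 1),
      (if P k then (r.choose k : ℝ) * q ^ k * (1 - q) ^ (r - k) else 0)
      ≤ ((1 - q + q * s) / s ^ c) ^ r := by
  have h1 : ((1 - q + q * s) / s ^ c) ^ r = ∑ k ∈ Finset.range (r + 1),
      ((r.choose k : ℝ) * q ^ k * (1 - q) ^ (r - k)) * s ^ ((k : ℝ) - c * r) := by
    rw [div_pow, add_comm (1 - q), add_pow, Finset.sum_div]
    refine Finset.sum_congr rfl fun k _ => ?_
    rw [Real.rpow_sub hs, Real.rpow_natCast, Real.rpow_mul hs.le, Real.rpow_natCast, mul_pow]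
    ring
  rw [h1]
  refine Finset.sum_le_sum fun k _ => ?_
  have h0 : 0 ≤ (r.choose k : ℝ) * q ^ k * (1 - q) ^ (r - k) := by
    have : 0 ≤ 1 - q := by linarith
    positivity
  split_ifs with h
  · exact le_mul_of_one_le_right h0 (hP k h)
  · positivity

lemma cdf_nonneg (r : ℕ) (q t : ℝ) (hq : 0 ≤ q) (hq1 : q ≤ 1) : 0 ≤ binomCdf r q t := by
  unfold binomCdf
  refine Finset.sum_nonneg fun k _ => ?_
  have : 0 ≤ 1 - q := by linarith
  split_ifs <;> positivity

lemma cdf_compl (r : ℕ) (q t : ℝ) : 1 - binomCdf r q t =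
    ∑ k ∈ Finset.range (r + 1),
      (if t < (k : ℝ) then (r.choose k : ℝ) * q ^ k * (1 - q) ^ (r - k) else 0) := by
  have h : (1 : ℝ) = ∑ k ∈ Finset.range (r + 1),
      (r.choose k : ℝ) * q ^ k * (1 - q) ^ (r - k) := by
    have := add_pow q (1 - q) r
    rw [add_sub_cancel, one_pow] at this
    refine this.trans ?_
    exact Finset.sum_congr rfl fun k _ => by ring
  unfold binomCdf
  nth_rewrite 1 [h]
  rw [← Finset.sum_sub_distrib]
  refine Finset.sum_congr rfl fun k _ => ?_
  by_cases hk : (k : ℝ) ≤ t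
  · simp [hk]
  · simp [hk, not_le.1 hk]

lemma cdf_le_one (r : ℕ) (q t : ℝ) (hq : 0 ≤ q) (hq1 : q ≤ 1) : binomCdf r q t ≤ 1 := by
  have := cdf_compl r q t
  have h2 : 0 ≤ 1 - binomCdf r q t := by
    rw [this]
    refine Finset.sum_nonneg fun k _ => ?_
    have : 0 ≤ 1 - q := by linarith
    split_ifs <;> positivity
  linarith

lemma poly_bd (x : ℝ) (hx : 0 < x) (hx3 : x ≤ 1 / 3) :
    x ^ 3 * (13 / 9 - x) ^ 10 ≤ (1 / 3) ^ 3 * (10 / 9) ^ 10 := by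
  have h1 : 3 * x ≤ Real.exp (3 * x - 1) := by
    have := Real.add_one_le_exp (3 * x - 1); linarith
  have h2 : (13 / 9 - x) * (9 / 10) ≤ Real.exp ((1 - 3 * x) * (3 / 10)) := by
    have := Real.add_one_le_exp ((1 - 3 * x) * (3 / 10)); linarith
  have h3 : (3 * x) ^ 3 * ((13 / 9 - x) * (9 / 10)) ^ 10 ≤ 1 := by
    calc _ ≤ (Real.exp (3 * x - 1)) ^ 3 * (Real.exp ((1 - 3 * x) * (3 / 10))) ^ 10 := by
          have : 0 ≤ (13 / 9 - x) * (9 / 10) := by linarith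
          gcongr
      _ = 1 := by
          rw [← Real.exp_nat_mul, ← Real.exp_nat_mul, ← Real.exp_add, Real.exp_eq_one_iff]
          push_cast; ring
  rw [mul_pow, mul_pow] at h3
  have : (3:ℝ)^3 * x ^ 3 * ((13 / 9 - x)^10 * (9 / 10) ^ 10) = (x ^ 3 * (13 / 9 - x) ^ 10) * (3 ^3 * (9/10)^10) := by ring
  rw [this, ← le_div_iff₀ (by positivity)] at h3
  refine h3.trans (by norm_num)

lemma tail_bd (r p : ℕ) (hp : 3 ≤ p) (t : ℝ) (ht : 2 / 5 * r ≤ t) (hr : 20 ≤ r) :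
    1 - binomCdf r (1 / (p : ℝ)) t ≤ (((10 / 11 : ℝ)) ^ (1 / 10 : ℝ)) ^ r * (9 * (1 / (p : ℝ) ^ 2)) := by
  have hp' : (3 : ℝ) ≤ p := by exact_mod_cast hp
  have hp0 : (0 : ℝ) < p := by linarith
  obtain ⟨x, hx⟩ : ∃ x : ℝ, x = 1 / (p : ℝ) := ⟨_, rfl⟩
  have hx0 : 0 < x := by rw [hx]; positivity
  have hx3 : x ≤ 1 / 3 := by rw [hx]; exact one_div_le_one_div_of_le (by norm_num) hp'
  have hs : (1 : ℝ) ≤ 4 / 9 / x := by rw [le_div_iff₀ hx0]; linarith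
  have h := cher r x (4 / 9 / x) (2 / 5) hx0.le (by linarith) (by linarith) (fun k => t < (k : ℝ))
    (fun k hk => Real.one_le_rpow hs (by linarith))
  have hw : (1 - x + x * (4 / 9 / x)) = 13 / 9 - x := by field_simp; ring
  rw [hw] at h
  rw [← hx, cdf_compl]
  refine h.trans ?_
  have hs0 : (0:ℝ) < 4 / 9 / x := by linarith
  have hbase : (13 / 9 - x) / (4 / 9 / x) ^ (2 / 5 : ℝ) ≤
      (10 / 11 : ℝ) ^ (1 / 10 : ℝ) * (3 * x) ^ (1 / 10 : ℝ) := by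
    refine le_of_pow_le_pow_left₀ (n := 10) (by norm_num) (by positivity) ?_
    rw [mul_pow, ← Real.rpow_mul_natCast (by norm_num), ← Real.rpow_mul_natCast (by positivity),
      div_pow, ← Real.rpow_mul_natCast hs0.le]
    norm_num
    have := poly_bd x hx0 hx3
    have e : (13 / 9 - x) ^ 10 / (4 / 9 / x) ^ 4 =
        (x ^ 3 * (13 / 9 - x) ^ 10) * x * (9 ^ 4 / 4 ^ 4) := by
      field_simp
    rw [e]
    nlinarith [mul_le_mul_of_nonneg_right this hx0.le]
  have hnn : 0 ≤ (13 / 9 - x) / (4 / 9 / x) ^ (2 / 5 : ℝ) := by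
    have : 0 ≤ 13 / 9 - x := by linarith
    positivity
  refine (pow_le_pow_left₀ hnn hbase r).trans ?_
  rw [mul_pow]
  gcongr
  calc ((3 * x) ^ (1 / 10 : ℝ)) ^ r ≤ ((3 * x) ^ (1 / 10 : ℝ)) ^ 20 :=
        pow_le_pow_of_le_one (by positivity)
          (Real.rpow_le_one (by positivity) (by linarith) (by norm_num)) hr
    _ = (3 * x) ^ 2 := by
        rw [← Real.rpow_mul_natCast (by positivity)]; norm_num
    _ = _ := by rw [hx]; ring

lemma low_bd (r : ℕ) (t : ℝ) (ht : t < 2 / 5 * r) :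
    binomCdf r (1 / 2) t ≤ (((10 / 11 : ℝ)) ^ (1 / 10 : ℝ)) ^ r := by
  have h := cher r (1 / 2) (2 / 3) (2 / 5) (by norm_num) (by norm_num) (by norm_num)
    (fun k => (k : ℝ) ≤ t)
    (fun k hk => Real.one_le_rpow_of_pos_of_le_one_of_nonpos (by norm_num) (by norm_num)
      (by linarith))
  refine h.trans ?_
  refine pow_le_pow_left₀ (by positivity) ?_ r
  refine le_of_pow_le_pow_left₀ (n := 10) (by norm_num) (by positivity) ?_
  rw [← Real.rpow_mul_natCast (by norm_num), div_pow, ← Real.rpow_mul_natCast (by norm_num)]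
  norm_num

lemma prod_bd {ι : Type*} (S : Finset ι) (f : ι → ℝ) (h0 : ∀ i, 0 ≤ f i) (h1 : ∀ i, f i ≤ 1) :
    1 - ∑ i ∈ S, (1 - f i) ≤ ∏ i ∈ S, f i := by
  classical
  induction S using Finset.induction_on with
  | empty => simp
  | insert a s ha ih =>
    rw [Finset.sum_insert ha, Finset.prod_insert ha]
    have hp : ∏ i ∈ s, f i ≤ 1 := Finset.prod_le_one (fun i _ => h0 i) (fun i _ => h1 i)
    nlinarith [h0 a, h1 a, mul_nonneg (sub_nonneg.2 (h1 a)) (sub_nonneg.2 hp)]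

lemma hasProd_inf {ι : Type*} (f : ι → ℝ) (h0 : ∀ i, 0 ≤ f i) (h1 : ∀ i, f i ≤ 1) :
    Multipliable f := by
  classical
  refine ⟨⨅ S : Finset ι, ∏ i ∈ S, f i, ?_⟩
  refine tendsto_atTop_ciInf (fun S T h => ?_) ⟨0, ?_⟩
  · rw [← Finset.prod_sdiff h]
    exact mul_le_of_le_one_left (Finset.prod_nonneg fun i _ => h0 i)
      (Finset.prod_le_one (fun i _ => h0 i) (fun i _ => h1 i))
  · rintro _ ⟨S, rfl⟩
    exact Finset.prod_nonneg fun i _ => h0 i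

theorem stmt_8 :
    ∃ A B : ℝ, 0 < A ∧ 0 < B ∧ ∀ r : ℕ, 2 ≤ r → ∀ t : ℝ,
      0 ≤ binomCdf r (1 / 2) t - codivCdf r t ∧
      binomCdf r (1 / 2) t - codivCdf r t ≤ A * Real.exp (-B * r) := by
  classical
  have hsum : Summable (fun p : Nat.Primes => 9 * (1 / ((p : ℕ) : ℝ) ^ 2)) :=
    ((Real.summable_one_div_nat_pow.2 (by norm_num : 1 < 2)).mul_left 9).comp_injective
      (i := fun p : Nat.Primes => (p : ℕ)) Subtype.val_injective
  set C : ℝ := ∑' p : Nat.Primes, 9 * (1 / ((p : ℕ) : ℝ) ^ 2) with hC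
  have hC0 : 0 ≤ C := tsum_nonneg fun p => by positivity
  set β : ℝ := (10 / 11 : ℝ) ^ (1 / 10 : ℝ) with hβ
  have hβ0 : 0 < β := by positivity
  have hβ1 : β < 1 := Real.rpow_lt_one (by norm_num) (by norm_num) (by norm_num)
  have hB : 0 < -Real.log β := by linarith [Real.log_neg hβ0 hβ1]
  have hexp : ∀ r : ℕ, Real.exp (-(-Real.log β) * r) = β ^ r := fun r => by
    rw [neg_neg, mul_comm, Real.exp_nat_mul, Real.exp_log hβ0]
  refine ⟨C + 1 + (β ^ 20)⁻¹, -Real.log β, by positivity, hB, fun r _ t => ?_⟩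
  rw [hexp]
  set f : Nat.Primes → ℝ := fun p => binomCdf r (1 / ((p : ℕ) : ℝ)) t with hf
  have hq : ∀ p : Nat.Primes, 1 / ((p : ℕ) : ℝ) ≤ 1 := fun p => by
    rw [div_le_one (by exact_mod_cast p.2.pos)]; exact_mod_cast p.2.one_lt.le
  have h0 : ∀ p, 0 ≤ f p := fun p => cdf_nonneg _ _ _ (by positivity) (hq p)
  have h1 : ∀ p, f p ≤ 1 := fun p => cdf_le_one _ _ _ (by positivity) (hq p)
  have hprod : Filter.Tendsto (fun S : Finset Nat.Primes => ∏ p ∈ S, f p) Filter.atTop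
      (nhds (codivCdf r t)) := (hasProd_inf f h0 h1).hasProd
  set two : Nat.Primes := ⟨2, Nat.prime_two⟩ with htwo
  have hf2 : f two = binomCdf r (1 / 2) t := by simp [hf, htwo]
  have hev : ∀ᶠ S : Finset Nat.Primes in Filter.atTop, {two} ⊆ S := Filter.eventually_ge_atTop _
  have hc0 : 0 ≤ codivCdf r t :=
    ge_of_tendsto' hprod fun S => Finset.prod_nonneg fun p _ => h0 p
  rw [← hf2]
  constructor
  · rw [sub_nonneg]
    refine le_of_tendsto hprod (hev.mono fun S hS => ?_)
    rw [← Finset.mul_prod_erase S f (hS (Finset.mem_singleton_self _))]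
    exact mul_le_of_le_one_right (h0 _) (Finset.prod_le_one (fun p _ => h0 p) (fun p _ => h1 p))
  · have hβr : 0 < β ^ r := by positivity
    have hi : 0 < (β ^ 20)⁻¹ := by positivity
    rcases lt_or_ge r 20 with hr | hr
    · have : β ^ 20 ≤ β ^ r := pow_le_pow_of_le_one hβ0.le hβ1.le hr.le
      have h3 : 1 ≤ (β ^ 20)⁻¹ * β ^ r := by
        rw [inv_mul_eq_div, le_div_iff₀ (by positivity)]; linarith
      nlinarith [h1 two, mul_nonneg hC0 hβr.le]
    · rcases lt_or_ge t (2 / 5 * r) with ht | ht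
      · have := low_bd r t ht
        rw [← hf2] at this
        nlinarith [mul_nonneg hC0 hβr.le, mul_pos hi hβr]
      · have key : f two - C * β ^ r ≤ codivCdf r t := by
          refine ge_of_tendsto hprod (hev.mono fun S hS => ?_)
          rw [← Finset.mul_prod_erase S f (hS (Finset.mem_singleton_self _))]
          have hb := prod_bd (S.erase two) f h0 h1
          have hs : ∑ p ∈ S.erase two, (1 - f p) ≤ C * β ^ r := by
            calc ∑ p ∈ S.erase two, (1 - f p)
                ≤ ∑ p ∈ S.erase two, β ^ r * (9 * (1 / ((p : ℕ) : ℝ) ^ 2)) := by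
                  refine Finset.sum_le_sum fun p hp => tail_bd r p ?_ t ht hr
                  have hne : (p : ℕ) ≠ 2 := fun h => (Finset.mem_erase.1 hp).1 (Subtype.ext h)
                  have := p.2.two_le
                  omega
              _ = β ^ r * ∑ p ∈ S.erase two, (9 * (1 / ((p : ℕ) : ℝ) ^ 2)) := by
                  rw [Finset.mul_sum]
              _ ≤ β ^ r * C := by
                  gcongr
                  exact hsum.sum_le_tsum _ (fun p _ => by positivity)
              _ = _ := mul_comm _ _
          have h5 : 0 ≤ C * β ^ r := by positivity
          nlinarith [mul_le_mul_of_nonneg_left (show 1 - C * β ^ r ≤ ∏ p ∈ S.erase two, f p by linarith) (h0 two), mul_nonneg h5 (sub_nonneg.2 (h1 two))]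
        nlinarith [mul_pos hi hβr]
end

section
/- Let W_r be a random variable with distribution function F_r(t) = ∏_p P(Bin(r, 1/p) ≤ t), the product over all primes. Then (W_r - r/2)/(√r/2) converges in distribution to the standard normal distribution N(0,1) as r → ∞. -/
open Finset

/-- The standard normal cumulative distribution function `Φ`. -/
noncomputable def stdNormalCdf (t : ℝ) : ℝ :=
  ∫ x in Set.Iic t, Real.exp (-x ^ 2 / 2) / Real.sqrt (2 * Real.pi)

theorem binomCdf_total (n : ℕ) (q : ℝ) :
    ∑ k ∈ Finset.range (n + 1), (n.choose k : ℝ) * q ^ k * (1 - q) ^ (n - k) = 1 := by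
  have h := add_pow q (1 - q) n
  rw [add_sub_cancel, one_pow] at h
  refine Eq.trans ?_ h.symm
  refine Finset.sum_congr rfl fun k _ => ?_
  ring

theorem binomCdf_nonneg (n : ℕ) {q : ℝ} (h0 : 0 ≤ q) (h1 : q ≤ 1) (t : ℝ) :
    0 ≤ binomCdf n q t := by
  have : 0 ≤ 1 - q := by linarith
  unfold binomCdf
  refine Finset.sum_nonneg fun k _ => ?_
  split_ifs <;> positivity

theorem binomCdf_le_one (n : ℕ) {q : ℝ} (h0 : 0 ≤ q) (h1 : q ≤ 1) (t : ℝ) :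
    binomCdf n q t ≤ 1 := by
  have : 0 ≤ 1 - q := by linarith
  rw [← binomCdf_total n q]
  unfold binomCdf
  refine Finset.sum_le_sum fun k _ => ?_
  split_ifs
  · exact le_rfl
  · positivity

theorem binomCdf_tail (n : ℕ) {q : ℝ} (h0 : 0 ≤ q) (h1 : q ≤ 1) (t : ℝ)
    (ht : 3 / 7 * (n : ℝ) ≤ t) {x : ℝ} (hx : 1 ≤ x) :
    1 - binomCdf n q t ≤ ((1 - q + q * x) / x ^ (3 / 7 : ℝ)) ^ n := by
  have hq : 0 ≤ 1 - q := by linarith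
  have hx0 : 0 < x := by linarith
  have hpow : (x ^ (3 / 7 : ℝ)) ^ n = x ^ (3 / 7 * (n : ℝ)) := by
    rw [Real.rpow_mul hx0.le, Real.rpow_natCast]
  have hpos : 0 < x ^ (3 / 7 * (n : ℝ)) := Real.rpow_pos_of_pos hx0 _
  rw [div_pow, hpow, le_div_iff₀ hpos]
  conv_lhs => rw [← binomCdf_total n q]
  unfold binomCdf
  rw [← Finset.sum_sub_distrib, add_comm (1 - q), add_pow, Finset.sum_mul]
  refine Finset.sum_le_sum fun k _ => ?_
  have hc : 0 ≤ (n.choose k : ℝ) * q ^ k * (1 - q) ^ (n - k) := by positivity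
  split_ifs with hk
  · rw [sub_self, zero_mul]; positivity
  · rw [sub_zero]
    have : x ^ (3 / 7 * (n : ℝ)) ≤ x ^ k := by
      rw [← Real.rpow_natCast x k]
      exact Real.rpow_le_rpow_of_exponent_le hx (by push Not at hk; linarith)
    calc _ ≤ (n.choose k : ℝ) * q ^ k * (1 - q) ^ (n - k) * x ^ k := by gcongr
      _ = _ := by rw [mul_pow]; ring

noncomputable def rhoAux (p : ℝ) : ℝ := 2 * (p - 1) / p / (p - 1) ^ (3 / 7 : ℝ)

theorem rhoAux_nonneg {p : ℝ} (hp : 2 ≤ p) : 0 ≤ rhoAux p := by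
  have : 0 ≤ p - 1 := by linarith
  unfold rhoAux
  positivity

theorem rhoAux_pow {p : ℝ} (hp : 2 ≤ p) : rhoAux p ^ 7 = 128 * (p - 1) ^ 4 / p ^ 7 := by
  have h1 : 0 < p - 1 := by linarith
  have : ((p - 1) ^ (3 / 7 : ℝ)) ^ 7 = (p - 1) ^ 3 := by
    rw [← Real.rpow_natCast, ← Real.rpow_mul h1.le, ← Real.rpow_natCast]
    norm_num
  unfold rhoAux
  rw [div_pow, this, div_pow]
  have : p ≠ 0 := by linarith
  field_simp
  ring

theorem rhoAux_le_one {p : ℝ} (hp : p = 2 ∨ 3 ≤ p) : rhoAux p ≤ 1 := by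
  rcases hp with rfl | hp
  · norm_num [rhoAux]
  have h2 : 2 ≤ p := by linarith
  by_contra h
  push Not at h
  have := one_lt_pow₀ h (n := 7) (by norm_num)
  rw [rhoAux_pow h2, lt_div_iff₀ (by positivity)] at this
  obtain ⟨v, rfl⟩ : ∃ v, p = 3 + v := ⟨p - 3, by ring⟩
  have hv : 0 ≤ v := by linarith
  have : 0 ≤ (3 + v) ^ 7 - 128 * (3 + v - 1) ^ 4 := by
    ring_nf; positivity
  linarith

theorem rhoAux_lt_one {p : ℝ} (hp : 3 ≤ p) : rhoAux p < 1 := by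
  have h2 : 2 ≤ p := by linarith
  by_contra h
  push Not at h
  have := one_le_pow₀ h (n := 7)
  rw [rhoAux_pow h2, le_div_iff₀ (by positivity)] at this
  obtain ⟨v, rfl⟩ : ∃ v, p = 3 + v := ⟨p - 3, by ring⟩
  have hv : 0 ≤ v := by linarith
  have : 0 < (3 + v) ^ 7 - 128 * (3 + v - 1) ^ 4 := by
    ring_nf; positivity
  linarith

theorem rhoAux_pow_le {p : ℝ} (hp : 2 ≤ p) : rhoAux p ^ 7 ≤ 128 * (1 / p ^ 3) := by
  rw [rhoAux_pow hp]
  have : 0 < p := by linarith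
  have h1 : (p - 1) ^ 4 ≤ p ^ 4 := pow_le_pow_left₀ (by linarith) (by linarith) _
  calc _ ≤ 128 * p ^ 4 / p ^ 7 := by gcongr
    _ = _ := by field_simp

theorem binomCdf_tail_rho (n : ℕ) {p : ℝ} (hp : 2 ≤ p) (t : ℝ)
    (ht : 3 / 7 * (n : ℝ) ≤ t) : 1 - binomCdf n (1 / p) t ≤ rhoAux p ^ n := by
  have h := binomCdf_tail n (q := 1 / p) (by positivity)
    (by rw [div_le_one] <;> linarith) t ht (x := p - 1) (by linarith)
  convert h using 3
  unfold rhoAux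
  congr 1
  have : p ≠ 0 := by linarith
  field_simp
  ring

theorem prime_cases (p : Nat.Primes) : ((p : ℕ) : ℝ) = 2 ∨ (3 : ℝ) ≤ ((p : ℕ) : ℝ) := by
  have := p.2.two_le
  rcases this.eq_or_lt with h | h
  · left; rw [← h]; norm_num
  · right; exact_mod_cast h

theorem prime_two_le (p : Nat.Primes) : (2 : ℝ) ≤ ((p : ℕ) : ℝ) := by
  exact_mod_cast p.2.two_le

theorem summable_bound : Summable fun p : Nat.Primes => 128 * (1 / ((p : ℕ) : ℝ) ^ 3) := by
  refine Summable.mul_left _ ?_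
  have h : Summable fun n : ℕ => 1 / (n : ℝ) ^ 3 := Real.summable_one_div_nat_pow.2 (by norm_num)
  exact h.comp_injective (i := fun p : Nat.Primes => (p : ℕ)) Subtype.val_injective

theorem rho_pow_bound (p : Nat.Primes) {n : ℕ} (hn : 7 ≤ n) :
    rhoAux ((p : ℕ) : ℝ) ^ n ≤ 128 * (1 / ((p : ℕ) : ℝ) ^ 3) :=
  (pow_le_pow_of_le_one (rhoAux_nonneg (prime_two_le p)) (rhoAux_le_one (prime_cases p)) hn).trans
    (rhoAux_pow_le (prime_two_le p))

theorem one_sub_sum_le_prod_aux {ι : Type*} (s : Finset ι) (b : ι → ℝ)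
    (h0 : ∀ i, 0 ≤ b i) (h1 : ∀ i, b i ≤ 1) :
    1 - ∑ i ∈ s, (1 - b i) ≤ ∏ i ∈ s, b i := by
  classical
  induction s using Finset.induction_on with
  | empty => simp
  | insert a s ha ih =>
    rw [Finset.sum_insert ha, Finset.prod_insert ha]
    have hP : ∏ i ∈ s, b i ≤ 1 := Finset.prod_le_one (fun i _ => h0 i) (fun i _ => h1 i)
    nlinarith [h0 a, h1 a, mul_nonneg (sub_nonneg.2 (h1 a)) (sub_nonneg.2 hP)]

def twoP : Nat.Primes := ⟨2, Nat.prime_two⟩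

open Classical in
noncomputable def errAux (n : ℕ) : ℝ :=
  ∑' p : Nat.Primes, if p = twoP then 0 else rhoAux ((p : ℕ) : ℝ) ^ n

open Classical in
theorem errAux_tendsto : Filter.Tendsto errAux Filter.atTop (nhds 0) := by
  have h := tendsto_tsum_of_dominated_convergence (𝓕 := Filter.atTop)
    (f := fun (n : ℕ) (p : Nat.Primes) => if p = twoP then 0 else rhoAux ((p : ℕ) : ℝ) ^ n)
    (g := fun _ => (0 : ℝ)) summable_bound ?_ ?_
  · rw [tsum_zero] at h
    exact h
  · intro p
    split_ifs with hp
    · exact tendsto_const_nhds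
    · refine tendsto_pow_atTop_nhds_zero_of_lt_one (rhoAux_nonneg (prime_two_le p)) (rhoAux_lt_one ?_)
      rcases prime_cases p with h | h
      · exact absurd (Subtype.ext (by exact_mod_cast h)) hp
      · exact h
  · filter_upwards [Filter.eventually_ge_atTop 7] with n hn p
    have h0 := rhoAux_nonneg (prime_two_le p)
    split_ifs with hp
    · rw [norm_zero]; positivity
    · rw [Real.norm_of_nonneg (by positivity)]
      exact rho_pow_bound p hn

theorem codiv_bounds (n : ℕ) (hn : 7 ≤ n) (t : ℝ) (ht : 3 / 7 * (n : ℝ) ≤ t) :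
    binomCdf n (1 / 2) t * (1 - errAux n) ≤ codivCdf n t ∧
      codivCdf n t ≤ binomCdf n (1 / 2) t := by
  classical
  set b : Nat.Primes → ℝ := fun p => binomCdf n (1 / ((p : ℕ) : ℝ)) t with hb
  have hq0 : ∀ p : Nat.Primes, (0 : ℝ) ≤ 1 / ((p : ℕ) : ℝ) := fun p => by positivity
  have hq1 : ∀ p : Nat.Primes, 1 / ((p : ℕ) : ℝ) ≤ 1 := fun p => by
    have := prime_two_le p
    rw [div_le_one] <;> linarith
  have h0 : ∀ p, 0 ≤ b p := fun p => binomCdf_nonneg n (hq0 p) (hq1 p) t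
  have h1 : ∀ p, b p ≤ 1 := fun p => binomCdf_le_one n (hq0 p) (hq1 p) t
  have htail : ∀ p, 1 - b p ≤ rhoAux ((p : ℕ) : ℝ) ^ n := fun p =>
    binomCdf_tail_rho n (prime_two_le p) t ht
  have hsumr : Summable fun p : Nat.Primes => rhoAux ((p : ℕ) : ℝ) ^ n :=
    Summable.of_nonneg_of_le (fun p => pow_nonneg (rhoAux_nonneg (prime_two_le p)) _)
      (fun p => rho_pow_bound p hn) summable_bound
  have hsum : Summable fun p => b p - 1 := by
    have : Summable fun p => 1 - b p :=
      Summable.of_nonneg_of_le (fun p => by linarith [h1 p]) htail hsumr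
    simpa using this.neg
  have hmul : Multipliable b := by
    simpa using Real.multipliable_one_add_of_summable hsum
  have hlim : Filter.Tendsto (fun s : Finset Nat.Primes => ∏ p ∈ s, b p) Filter.atTop
      (nhds (codivCdf n t)) := hmul.hasProd
  have hb2 : b twoP = binomCdf n (1 / 2) t := by simp [hb, twoP]
  have hsume : Summable fun p : Nat.Primes =>
      if p = twoP then 0 else rhoAux ((p : ℕ) : ℝ) ^ n := by
    refine Summable.of_nonneg_of_le (fun p => ?_) (fun p => ?_) hsumr
    · have := rhoAux_nonneg (prime_two_le p)
      split_ifs <;> positivity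
    · have := rhoAux_nonneg (prime_two_le p)
      split_ifs
      · positivity
      · exact le_rfl
  rw [← hb2]
  constructor
  · refine ge_of_tendsto hlim ?_
    filter_upwards [Filter.eventually_ge_atTop {twoP}] with s hs
    have h2 : twoP ∈ s := hs (Finset.mem_singleton_self _)
    rw [← Finset.mul_prod_erase s b h2]
    refine mul_le_mul_of_nonneg_left ?_ (h0 _)
    refine le_trans ?_ (one_sub_sum_le_prod_aux (s.erase twoP) b h0 h1)
    refine sub_le_sub_left ?_ _
    calc ∑ p ∈ s.erase twoP, (1 - b p)
        ≤ ∑ p ∈ s.erase twoP, (if p = twoP then 0 else rhoAux ((p : ℕ) : ℝ) ^ n) := by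
          refine Finset.sum_le_sum fun p hp => ?_
          rw [if_neg (Finset.ne_of_mem_erase hp)]
          exact htail p
      _ ≤ errAux n := by
          refine (hsume.sum_le_tsum _ fun p _ => ?_).trans_eq ?_
          · have := rhoAux_nonneg (prime_two_le p)
            split_ifs <;> positivity
          · unfold errAux; congr
  · refine le_of_tendsto hlim ?_
    filter_upwards [Filter.eventually_ge_atTop {twoP}] with s hs
    have h2 : twoP ∈ s := hs (Finset.mem_singleton_self _)
    rw [← Finset.mul_prod_erase s b h2]
    exact mul_le_of_le_one_right (h0 _) (Finset.prod_le_one (fun i _ => h0 i) (fun i _ => h1 i))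

open MeasureTheory ProbabilityTheory

noncomputable def halfI : unitInterval := ⟨1 / 2, by norm_num, by norm_num⟩

noncomputable def stdMap (n : ℕ) (k : ℕ) : ℝ := (Real.sqrt n)⁻¹ * (2 * k - n)

noncomputable def nuAux (n : ℕ) : ProbabilityMeasure ℝ :=
  ⟨(binomial n halfI).map (stdMap n), Measure.isProbabilityMeasure_map .of_discrete⟩

theorem charFun_nuAux (n : ℕ) (t : ℝ) :
    charFun (nuAux n : Measure ℝ) t =
      (charFun ((bernoulliMeasure (1 : ℝ) (-1) halfI).map id) ((Real.sqrt n)⁻¹ * t)) ^ n := by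
  rw [Measure.map_id, charFun_apply_real, charFun_apply_real, integral_bernoulliMeasure]
  change ∫ x, _ ∂((binomial n halfI).map (stdMap n)) = _
  rw [integral_map .of_discrete (by fun_prop), integral_binomial, add_pow]
  rw [Nat.range_succ_eq_Iic]
  refine Finset.sum_congr rfl fun k hk => ?_
  have hk' : k ≤ n := Finset.mem_Iic.1 hk
  obtain ⟨m, rfl⟩ := Nat.exists_eq_add_of_le hk'
  simp only [Complex.real_smul, mul_pow, ← Complex.exp_nat_mul, add_tsub_cancel_left]
  have : Complex.exp (t * (stdMap (k + m) k : ℝ) * Complex.I) =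
      Complex.exp (k * (((Real.sqrt (k + m : ℕ))⁻¹ * t : ℝ) * (1 : ℝ) * Complex.I)) *
      Complex.exp (m * (((Real.sqrt (k + m : ℕ))⁻¹ * t : ℝ) * (-1 : ℝ) * Complex.I)) := by
    rw [← Complex.exp_add]
    congr 1
    unfold stdMap
    push_cast
    ring
  rw [this]
  push_cast
  ring

theorem tendsto_nuAux :
    Filter.Tendsto nuAux Filter.atTop
      (nhds (⟨gaussianReal 0 1, inferInstance⟩ : ProbabilityMeasure ℝ)) := by
  refine ProbabilityMeasure.tendsto_iff_tendsto_charFun.2 fun t => ?_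
  have h := tendsto_charFun_inv_sqrt_mul_pow (P := bernoulliMeasure (1 : ℝ) (-1) halfI) (X := id)
    aemeasurable_id (by rw [integral_bernoulliMeasure]; simp [halfI]; norm_num)
    (by rw [integral_bernoulliMeasure]; simp) t
  simp_rw [charFun_nuAux]
  convert h using 2
  simp [charFun_gaussianReal, neg_div]

theorem nuAux_Iic (n : ℕ) (hn : 0 < n) (t : ℝ) :
    (nuAux n : Measure ℝ).real (Set.Iic t) =
      binomCdf n (1 / 2) ((n : ℝ) / 2 + t * (Real.sqrt n / 2)) := by
  change ((binomial n halfI).map (stdMap n)).real _ = _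
  have hm : Measurable (stdMap n) := .of_discrete
  have hs : 0 < Real.sqrt n := Real.sqrt_pos.2 (by exact_mod_cast hn)
  rw [map_measureReal_apply hm measurableSet_Iic,
    ← integral_indicator_one (hm measurableSet_Iic), integral_binomial]
  unfold binomCdf
  rw [Nat.range_succ_eq_Iic]
  refine Finset.sum_congr rfl fun k _ => ?_
  have : stdMap n k ≤ t ↔ (k : ℝ) ≤ (n : ℝ) / 2 + t * (Real.sqrt n / 2) := by
    unfold stdMap
    rw [inv_mul_le_iff₀ hs]
    constructor <;> intro h <;> nlinarith
  by_cases hk : (k : ℝ) ≤ (n : ℝ) / 2 + t * (Real.sqrt n / 2)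
  · rw [if_pos hk, Set.indicator_of_mem (by exact this.2 hk)]
    simp [halfI]
  · rw [if_neg hk, Set.indicator_of_notMem (by exact fun h => hk (this.1 h))]
    simp

theorem gaussian_Iic (t : ℝ) : (gaussianReal 0 1).real (Set.Iic t) = stdNormalCdf t := by
  rw [measureReal_def, gaussianReal_apply_eq_integral _ one_ne_zero, ENNReal.toReal_ofReal]
  · unfold stdNormalCdf
    congr 1
    ext x
    simp [gaussianPDFReal, div_eq_inv_mul]
  · exact integral_nonneg fun x => gaussianPDFReal_nonneg _ _ _

theorem binom_clt (t : ℝ) :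
    Filter.Tendsto (fun r : ℕ => binomCdf r (1 / 2) ((r : ℝ) / 2 + t * (Real.sqrt r / 2)))
      Filter.atTop (nhds (stdNormalCdf t)) := by
  have h := ProbabilityMeasure.tendsto_measure_of_null_frontier_of_tendsto' tendsto_nuAux
    (E := Set.Iic t) (by
      rw [frontier_Iic]
      have := nullSingletonClass_gaussianReal (μ := 0) (v := 1) one_ne_zero
      exact measure_singleton (μ := gaussianReal 0 1) t)
  have h2 := (ENNReal.tendsto_toReal (measure_ne_top (gaussianReal 0 1) (Set.Iic t))).comp h
  have e : ((gaussianReal 0 1) (Set.Iic t)).toReal = stdNormalCdf t := gaussian_Iic t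
  rw [← e]
  refine h2.congr' ?_
  filter_upwards [Filter.eventually_gt_atTop 0] with n hn
  exact nuAux_Iic n hn t

/-- `(W_r - r/2)/(√r/2)` converges in distribution to `N(0,1)` as `r → ∞`:
the CDF of the normalized index of codivisibility converges pointwise to `Φ`
(which suffices since `Φ` is continuous). -/
theorem stmt_10 (t : ℝ) :
    Filter.Tendsto (fun r : ℕ => codivCdf r ((r : ℝ) / 2 + t * (Real.sqrt r / 2)))
      Filter.atTop (nhds (stdNormalCdf t)) := by
  have hc := binom_clt t
  have hev : ∀ᶠ r : ℕ in Filter.atTop, 7 ≤ r ∧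
      3 / 7 * (r : ℝ) ≤ (r : ℝ) / 2 + t * (Real.sqrt r / 2) := by
    have hs : Filter.Tendsto (fun r : ℕ => Real.sqrt r) Filter.atTop Filter.atTop :=
      Real.tendsto_sqrt_atTop.comp tendsto_natCast_atTop_atTop
    filter_upwards [Filter.eventually_ge_atTop 7, hs.eventually_ge_atTop (-7 * t)] with r h7 hr
    refine ⟨h7, ?_⟩
    have h1 := Real.sq_sqrt (Nat.cast_nonneg (α := ℝ) r)
    nlinarith [mul_nonneg (Real.sqrt_nonneg (r : ℝ)) (sub_nonneg.2 hr)]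
  have hlow := hc.mul (errAux_tendsto.const_sub 1)
  rw [sub_zero, mul_one] at hlow
  refine tendsto_of_tendsto_of_tendsto_of_le_of_le' hlow hc ?_ ?_
  · filter_upwards [hev] with r hr
    exact (codiv_bounds r hr.1 _ hr.2).1
  · filter_upwards [hev] with r hr
    exact (codiv_bounds r hr.1 _ hr.2).2
end
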